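/- Under assumptions (A1)–(A4), let c be the unique fixed point of f₀∘f₁ in [1−x₀, y₀]. For every ρ > 0 there exists δ > 0 such that for every ξ ∈ (0, 1/2) there exists a natural number m such that for all n ≥ m and all x ∈ [ξ, 1−ξ], ℙ_x({ω ∈ Σ : f^n_ω(x) ∈ (c−ρ, c+ρ)}) ≥ δ. -/

import Mathlib

/-
Formalization of the Alsedà–Misiurewicz system setup:
`f0, f1` are the piecewise-linear interval homeomorphisms, `iter` the random
iteration along ω ∈ Σ = {0,1}^ℕ, `IsKernel` characterises the family x ↦ ℙ_x by
its values on cylinder sets, `Pop` is the Markov operator (as a set function),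
`Stationary` expresses P-invariance for probability measures on (0,1), `U` is
the dual operator, and `A1`–`A4` are the assumptions of the paper.
-/

open MeasureTheory Filter Set
open scoped ENNReal Topology

namespace AM

noncomputable def f0 (x₀ y₀ : ℝ) (x : ℝ) : ℝ :=
  if x ≤ x₀ then (y₀ / x₀) * x else ((1 - y₀) / (1 - x₀)) * (x - 1) + 1

noncomputable def f1 (x₀ y₀ : ℝ) (x : ℝ) : ℝ := 1 - f0 x₀ y₀ (1 - x)

/-- `fb b` is `f₁` if `b = true`, and `f₀` if `b = false`. -/
noncomputable def fb (x₀ y₀ : ℝ) (b : Bool) : ℝ → ℝ :=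
  if b then f1 x₀ y₀ else f0 x₀ y₀

/-- `iter x₀ y₀ ω n x = f^n_ω(x) = f_{ω (n-1)} ∘ ⋯ ∘ f_{ω 0} (x)`, with `f^0_ω = id`. -/
noncomputable def iter (x₀ y₀ : ℝ) (ω : ℕ → Bool) : ℕ → ℝ → ℝ
  | 0, x => x
  | n + 1, x => fb x₀ y₀ (ω n) (iter x₀ y₀ ω n x)

/-- `cylProb x₀ y₀ p₀ p₁ x w = p_{i₁}(x) p_{i₂}(f_{i₁} x) ⋯` for the word `w = (i₁, …, i_k)`. -/
noncomputable def cylProb (x₀ y₀ : ℝ) (p₀ p₁ : ℝ → ℝ) : ℝ → List Bool → ℝ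
  | _, [] => 1
  | x, b :: w => (if b then p₁ x else p₀ x) * cylProb x₀ y₀ p₀ p₁ (fb x₀ y₀ b x) w

/-- The cylinder set of sequences starting with the word `w`. -/
def cyl (w : List Bool) : Set (ℕ → Bool) := {ω | ∀ j : Fin w.length, ω j = w.get j}

/-- `IsKernel x₀ y₀ p₀ p₁ Pm` says that `Pm x = ℙ_x` for all `x ∈ (0,1)`, i.e. `Pm x` gives
every cylinder set its prescribed probability (this determines `Pm x` uniquely and makes it a
probability measure, since the empty word gives `Pm x univ = 1`). -/
def IsKernel (x₀ y₀ : ℝ) (p₀ p₁ : ℝ → ℝ) (Pm : ℝ → Measure (ℕ → Bool)) : Prop :=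
  ∀ x ∈ Ioo (0:ℝ) 1, ∀ w : List Bool,
    Pm x (cyl w) = ENNReal.ofReal (cylProb x₀ y₀ p₀ p₁ x w)

/-- The Markov operator `P`, as a set function:
`Pop μ A = ∫_{f₀⁻¹(A)} p₀ dμ + ∫_{f₁⁻¹(A)} p₁ dμ`. -/
noncomputable def Pop (x₀ y₀ : ℝ) (p₀ p₁ : ℝ → ℝ) (μ : Measure ℝ) (A : Set ℝ) : ℝ≥0∞ :=
  (∫⁻ x in f0 x₀ y₀ ⁻¹' A, ENNReal.ofReal (p₀ x) ∂μ) +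
    ∫⁻ x in f1 x₀ y₀ ⁻¹' A, ENNReal.ofReal (p₁ x) ∂μ

/-- A stationary (P-invariant) Borel probability measure on (0,1). -/
def Stationary (x₀ y₀ : ℝ) (p₀ p₁ : ℝ → ℝ) (μ : Measure ℝ) : Prop :=
  IsProbabilityMeasure μ ∧ μ (Ioo 0 1) = 1 ∧
    ∀ A : Set ℝ, MeasurableSet A → A ⊆ Ioo 0 1 → μ A = Pop x₀ y₀ p₀ p₁ μ A

/-- The dual operator `Uφ(x) = p₀(x) φ(f₀ x) + p₁(x) φ(f₁ x)`. -/
noncomputable def U (x₀ y₀ : ℝ) (p₀ p₁ : ℝ → ℝ) (φ : ℝ → ℝ) : ℝ → ℝ :=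
  fun x => p₀ x * φ (f0 x₀ y₀ x) + p₁ x * φ (f1 x₀ y₀ x)

/-- Assumption (A1): `1/2 < x₀ < 1` and `1/2 ≤ y₀ < x₀`. -/
def A1 (x₀ y₀ : ℝ) : Prop := 1/2 < x₀ ∧ x₀ < 1 ∧ 1/2 ≤ y₀ ∧ y₀ < x₀

/-- Assumption (A2): Dini continuity of `p₀, p₁`; `β` is a modulus of continuity for both, with
`∑ₙ β(C tⁿ) < ∞` for all `C ≥ 0`, `0 < t < 1`. (Such a `β` exists iff the least modulus of
continuity has this summability property.) -/
def A2 (p₀ p₁ : ℝ → ℝ) : Prop :=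
  ∃ β : ℝ → ℝ,
    (∀ t : ℝ, ∀ x ∈ Icc (0:ℝ) 1, ∀ y ∈ Icc (0:ℝ) 1, |x - y| ≤ t →
      |p₀ x - p₀ y| ≤ β t ∧ |p₁ x - p₁ y| ≤ β t) ∧
    (∀ C : ℝ, 0 ≤ C → ∀ t : ℝ, 0 < t → t < 1 → Summable fun n : ℕ => β (C * t ^ n))

/-- Assumption (A3): `p₀, p₁` are continuous, `p₀ + p₁ = 1`, and `0 < pᵢ < 1` on `[0,1]`. -/
def A3 (p₀ p₁ : ℝ → ℝ) : Prop :=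
  ContinuousOn p₀ (Icc 0 1) ∧ ContinuousOn p₁ (Icc 0 1) ∧
    ∀ x ∈ Icc (0:ℝ) 1, p₀ x + p₁ x = 1 ∧ 0 < p₀ x ∧ p₀ x < 1 ∧ 0 < p₁ x ∧ p₁ x < 1

/-- Assumption (A4): the average Lyapunov exponents at 0 and 1 are positive
(`a₀ = y₀/x₀`, `a₁ = (1-y₀)/(1-x₀)`). -/
def A4 (x₀ y₀ : ℝ) (p₀ p₁ : ℝ → ℝ) : Prop :=
  0 < p₀ 0 * Real.log (y₀ / x₀) + p₁ 0 * Real.log ((1 - y₀) / (1 - x₀)) ∧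
    0 < p₀ 1 * Real.log ((1 - y₀) / (1 - x₀)) + p₁ 1 * Real.log (y₀ / x₀)

end AM

namespace AM

section Maps

variable {x₀ y₀ : ℝ}

lemma A1.a₀_mem (h : A1 x₀ y₀) : 0 < y₀ / x₀ ∧ y₀ / x₀ < 1 := by
  obtain ⟨h1, h2, h3, h4⟩ := h
  exact ⟨by apply div_pos <;> linarith, by rw [div_lt_one] <;> linarith⟩

lemma A1.one_lt_a₁ (h : A1 x₀ y₀) : 1 < (1 - y₀) / (1 - x₀) := by
  obtain ⟨h1, h2, h3, h4⟩ := h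
  rw [one_lt_div] <;> linarith

lemma A1.a₀_mul (h : A1 x₀ y₀) : y₀ / x₀ * x₀ = y₀ := by
  obtain ⟨h1, h2, h3, h4⟩ := h
  exact div_mul_cancel₀ _ (by linarith)

lemma A1.a₁_mul (h : A1 x₀ y₀) : (1 - y₀) / (1 - x₀) * (1 - x₀) = 1 - y₀ := by
  obtain ⟨h1, h2, h3, h4⟩ := h
  exact div_mul_cancel₀ _ (by linarith)

lemma A1.one_lt_a₀_mul_a₁ (h : A1 x₀ y₀) : 1 < (1 - y₀) / (1 - x₀) * (y₀ / x₀) := by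
  obtain ⟨h1, h2, h3, h4⟩ := h
  rw [div_mul_div_comm, one_lt_div (by apply mul_pos <;> linarith)]
  nlinarith

lemma A1.a₀_mul_y₀ (h : A1 x₀ y₀) : 1 - x₀ ≤ y₀ / x₀ * y₀ := by
  obtain ⟨h1, h2, h3, h4⟩ := h
  rw [div_mul_eq_mul_div, le_div_iff₀ (by linarith)]
  nlinarith [sq_nonneg (x₀ - 1 / 2)]

lemma A1.a₀_mul_one_sub (h : A1 x₀ y₀) : 1 - x₀ ≤ y₀ / x₀ * (1 - y₀) := by
  obtain ⟨h1, h2, h3, h4⟩ := h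
  rw [div_mul_eq_mul_div, le_div_iff₀ (by linarith)]
  nlinarith

lemma f0_of_le {x : ℝ} (hx : x ≤ x₀) : f0 x₀ y₀ x = y₀ / x₀ * x := by
  simp [f0, hx]

lemma f0_of_ge (h : A1 x₀ y₀) {x : ℝ} (hx : x₀ ≤ x) :
    f0 x₀ y₀ x = 1 - (1 - y₀) / (1 - x₀) * (1 - x) := by
  rcases hx.eq_or_lt with rfl | hx
  · rw [f0_of_le le_rfl, h.a₀_mul, h.a₁_mul]; ring
  · rw [f0, if_neg hx.not_ge]; ring

lemma f1_of_ge {x : ℝ} (hx : 1 - x₀ ≤ x) : f1 x₀ y₀ x = 1 - y₀ / x₀ * (1 - x) := by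
  rw [f1, f0_of_le (by linarith)]

lemma f1_of_le (h : A1 x₀ y₀) {x : ℝ} (hx : x ≤ 1 - x₀) :
    f1 x₀ y₀ x = (1 - y₀) / (1 - x₀) * x := by
  rw [f1, f0_of_ge h (by linarith)]; ring

lemma continuous_f0 (h : A1 x₀ y₀) : Continuous (f0 x₀ y₀) := by
  unfold f0
  refine Continuous.if_le (by fun_prop) (by fun_prop) (by fun_prop) (by fun_prop) ?_
  rintro x rfl
  have := h.a₀_mul
  have := h.a₁_mul
  linarith

lemma continuous_f1 (h : A1 x₀ y₀) : Continuous (f1 x₀ y₀) := by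
  unfold f1
  have := continuous_f0 h
  fun_prop

lemma mul_le_f0 (h : A1 x₀ y₀) {x : ℝ} : y₀ / x₀ * x ≤ f0 x₀ y₀ x := by
  rcases le_total x x₀ with hx | hx
  · rw [f0_of_le hx]
  · rw [f0_of_ge h hx]
    nlinarith [h.a₀_mul, h.a₁_mul, h.a₀_mem.2, h.one_lt_a₁]

lemma f0_le_self (h : A1 x₀ y₀) {x : ℝ} (hx : x ∈ Ioo (0 : ℝ) 1) : f0 x₀ y₀ x ≤ x := by
  rcases le_total x x₀ with h' | h'
  · rw [f0_of_le h']
    nlinarith [h.a₀_mem.2, hx.1]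
  · rw [f0_of_ge h h']
    nlinarith [h.one_lt_a₁, hx.2]

lemma f0_mem (h : A1 x₀ y₀) {x : ℝ} (hx : x ∈ Ioo (0 : ℝ) 1) : f0 x₀ y₀ x ∈ Ioo (0 : ℝ) 1 :=
  ⟨(mul_pos h.a₀_mem.1 hx.1).trans_le (mul_le_f0 h), (f0_le_self h hx).trans_lt hx.2⟩

lemma one_sub_mem {x : ℝ} (hx : x ∈ Ioo (0 : ℝ) 1) : 1 - x ∈ Ioo (0 : ℝ) 1 :=
  ⟨by linarith [hx.2], by linarith [hx.1]⟩

lemma f1_mem (h : A1 x₀ y₀) {x : ℝ} (hx : x ∈ Ioo (0 : ℝ) 1) : f1 x₀ y₀ x ∈ Ioo (0 : ℝ) 1 :=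
  one_sub_mem (f0_mem h (one_sub_mem hx))

lemma self_le_f1 (h : A1 x₀ y₀) {x : ℝ} (hx : x ∈ Ioo (0 : ℝ) 1) : x ≤ f1 x₀ y₀ x := by
  have := f0_le_self h (one_sub_mem hx)
  rw [f1]; linarith

lemma fb_mem (h : A1 x₀ y₀) (b : Bool) {x : ℝ} (hx : x ∈ Ioo (0 : ℝ) 1) :
    fb x₀ y₀ b x ∈ Ioo (0 : ℝ) 1 := by
  cases b
  · exact f0_mem h hx
  · exact f1_mem h hx

end Maps

section Reach

variable {x₀ y₀ : ℝ}

/-- The points that are moved into `S` by at least one of the two maps. -/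
def pre (x₀ y₀ : ℝ) (S : Set ℝ) : Set ℝ := f0 x₀ y₀ ⁻¹' S ∪ f1 x₀ y₀ ⁻¹' S

lemma pre_mono : Monotone (pre x₀ y₀) := fun _ _ h =>
  union_subset_union (preimage_mono h) (preimage_mono h)

lemma mem_pre_iterate_succ {S : Set ℝ} {n : ℕ} {x : ℝ} :
    x ∈ (pre x₀ y₀)^[n + 1] S ↔
      f0 x₀ y₀ x ∈ (pre x₀ y₀)^[n] S ∨ f1 x₀ y₀ x ∈ (pre x₀ y₀)^[n] S := by
  rw [Function.iterate_succ_apply']; rfl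

lemma pre_iterate_trans {S T : Set ℝ} {m n : ℕ} {x : ℝ} (hx : x ∈ (pre x₀ y₀)^[m] S)
    (hST : S ⊆ (pre x₀ y₀)^[n] T) : x ∈ (pre x₀ y₀)^[m + n] T := by
  rw [Function.iterate_add_apply]
  exact pre_mono.iterate m hST hx

lemma isOpen_pre_iterate (h : A1 x₀ y₀) {S : Set ℝ} (hS : IsOpen S) (n : ℕ) :
    IsOpen ((pre x₀ y₀)^[n] S) := by
  induction n with
  | zero => exact hS
  | succ n ih =>
    rw [Function.iterate_succ_apply']
    exact (ih.preimage (continuous_f0 h)).union (ih.preimage (continuous_f1 h))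

lemma not_of_forall_mul {P : ℝ → Prop} {q M x : ℝ} (hq : 1 < q) (hx : 0 < x)
    (hstep : ∀ y, P y → P (q * y)) (hbound : ∀ y, P y → y ≤ M) : ¬ P x := by
  intro hP
  have key : ∀ n : ℕ, P (q ^ n * x) := by
    intro n
    induction n with
    | zero => simpa using hP
    | succ n ih => have := hstep _ ih; rwa [← mul_assoc, ← pow_succ'] at this
  obtain ⟨n, hn⟩ := pow_unbounded_of_one_lt (M / x) hq
  rw [div_lt_iff₀ hx] at hn
  exact (hbound _ (key n)).not_gt hn

/-- From the trapping interval one can return to it in an odd number of steps. -/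
lemma exists_odd_return (h : A1 x₀ y₀) {x : ℝ} (hx : x ∈ Icc (1 - x₀) y₀) :
    ∃ n, Odd n ∧ x ∈ (pre x₀ y₀)^[n] (Icc (1 - x₀) y₀) := by
  have hA := h
  obtain ⟨h1, h2, h3, h4⟩ := hA
  by_contra hcon
  refine not_of_forall_mul (x := x) (M := y₀) (P := fun y => y ∈ Icc (1 - x₀) y₀ ∧
    ¬ ∃ n, Odd n ∧ y ∈ (pre x₀ y₀)^[n] (Icc (1 - x₀) y₀)) h.one_lt_a₀_mul_a₁
    (by linarith [hx.1]) ?_ (fun y hy => hy.1.2) ⟨hx, hcon⟩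
  rintro y ⟨hy, hno⟩
  have hf0 : f0 x₀ y₀ y = y₀ / x₀ * y := f0_of_le (hy.2.trans h4.le)
  have hle : y₀ / x₀ * y ≤ y := by nlinarith [h.a₀_mem.2, hy.1]
  have hlt : y₀ / x₀ * y < 1 - x₀ := by
    by_contra! hge
    refine hno ⟨1, odd_one, mem_pre_iterate_succ.2 (Or.inl ?_)⟩
    rw [hf0]
    exact ⟨hge, hle.trans hy.2⟩
  have hf1 := f1_of_le h hlt.le
  rw [← mul_assoc] at hf1
  have hup : (1 - y₀) / (1 - x₀) * (y₀ / x₀) * y ≤ 1 - y₀ := by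
    have := mul_le_mul_of_nonneg_left hlt.le (zero_le_one.trans h.one_lt_a₁.le)
    rw [h.a₁_mul] at this
    linarith
  have hlow : y ≤ (1 - y₀) / (1 - x₀) * (y₀ / x₀) * y := by
    nlinarith [h.one_lt_a₀_mul_a₁, hy.1]
  refine ⟨⟨hy.1.trans hlow, by linarith⟩, ?_⟩
  rintro ⟨n, hn, hmem⟩
  refine hno ⟨n + 1 + 1, by simpa [Nat.odd_add_one] using hn,
    mem_pre_iterate_succ.2 (Or.inl (mem_pre_iterate_succ.2 (Or.inr ?_)))⟩
  rwa [hf0, hf1]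

/-- Every point of `(0,1)` can be moved into the trapping interval. -/
lemma exists_reach (h : A1 x₀ y₀) {x : ℝ} (hx : x ∈ Ioo (0 : ℝ) 1) :
    ∃ n, x ∈ (pre x₀ y₀)^[n] (Icc (1 - x₀) y₀) := by
  have hA := h
  obtain ⟨h1, h2, h3, h4⟩ := hA
  by_contra hcon
  rcases lt_or_ge x (1 - x₀) with hlt | hge
  · refine not_of_forall_mul (x := x) (M := 1 - x₀) (P := fun y => y < 1 - x₀ ∧
      ¬ ∃ n, y ∈ (pre x₀ y₀)^[n] (Icc (1 - x₀) y₀)) h.one_lt_a₁ hx.1 ?_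
      (fun y hy => hy.1.le) ⟨hlt, hcon⟩
    rintro y ⟨hy, hno⟩
    have hf1 := f1_of_le h hy.le
    have hno' : ¬ ∃ n, (1 - y₀) / (1 - x₀) * y ∈ (pre x₀ y₀)^[n] (Icc (1 - x₀) y₀) := by
      rintro ⟨n, hn⟩
      exact hno ⟨n + 1, mem_pre_iterate_succ.2 (Or.inr (by rwa [hf1]))⟩
    refine ⟨?_, hno'⟩
    by_contra! hge
    have := mul_le_mul_of_nonneg_left hy.le (zero_le_one.trans h.one_lt_a₁.le)
    rw [h.a₁_mul] at this
    exact hno' ⟨0, hge, by linarith⟩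
  · have mid : ∀ y, 1 - x₀ ≤ y → y ≤ x₀ →
        ∃ n, y ∈ (pre x₀ y₀)^[n] (Icc (1 - x₀) y₀) := by
      intro y hy hy'
      rcases le_total y y₀ with hle | hge
      · exact ⟨0, hy, hle⟩
      · refine ⟨1, mem_pre_iterate_succ.2 (Or.inl ?_)⟩
        have e1 := mul_le_mul_of_nonneg_left hge h.a₀_mem.1.le
        have e2 := mul_le_mul_of_nonneg_left hy' h.a₀_mem.1.le
        rw [h.a₀_mul] at e2
        rw [f0_of_le hy']
        exact ⟨h.a₀_mul_y₀.trans e1, e2⟩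
    have hgt : x₀ < x := by
      by_contra! hle
      exact hcon (mid x hge hle)
    refine not_of_forall_mul (x := 1 - x) (M := 1 - x₀) (P := fun y => y < 1 - x₀ ∧
      ¬ ∃ n, 1 - y ∈ (pre x₀ y₀)^[n] (Icc (1 - x₀) y₀)) h.one_lt_a₁ (by linarith [hx.2]) ?_
      (fun y hy => hy.1.le) ⟨by linarith, by simpa using hcon⟩
    rintro y ⟨hy, hno⟩
    have hf0 := f0_of_ge h (show x₀ ≤ 1 - y by linarith)
    rw [sub_sub_cancel] at hf0
    have hno' : ¬ ∃ n, 1 - (1 - y₀) / (1 - x₀) * y ∈ (pre x₀ y₀)^[n] (Icc (1 - x₀) y₀) := by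
      rintro ⟨n, hn⟩
      exact hno ⟨n + 1, mem_pre_iterate_succ.2 (Or.inl (by rwa [hf0]))⟩
    refine ⟨?_, hno'⟩
    by_contra! hge
    have := mul_le_mul_of_nonneg_left hy.le (zero_le_one.trans h.one_lt_a₁.le)
    rw [h.a₁_mul] at this
    exact hno' (mid _ (by linarith) (by linarith))

lemma f0_f1_of_mem (h : A1 x₀ y₀) {x : ℝ} (hx : x ∈ Icc (1 - x₀) y₀) :
    f0 x₀ y₀ (f1 x₀ y₀ x) = y₀ / x₀ * (1 - y₀ / x₀ * (1 - x)) := by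
  rw [f1_of_ge hx.1, f0_of_le]
  have := mul_le_mul_of_nonneg_left (sub_le_sub_left hx.2 1) h.a₀_mem.1.le
  linarith [h.a₀_mul_one_sub]

variable {c : ℝ}

lemma f0_f1_sub (h : A1 x₀ y₀) (hc : c ∈ Ioo (1 - x₀) y₀) (hfix : f0 x₀ y₀ (f1 x₀ y₀ c) = c)
    {x : ℝ} (hx : x ∈ Icc (1 - x₀) y₀) :
    f0 x₀ y₀ (f1 x₀ y₀ x) - c = (y₀ / x₀) ^ 2 * (x - c) := by
  rw [f0_f1_of_mem h (Ioo_subset_Icc_self hc)] at hfix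
  rw [f0_f1_of_mem h hx]
  linear_combination hfix

lemma f0_f1_mem (h : A1 x₀ y₀) (hc : c ∈ Ioo (1 - x₀) y₀) (hfix : f0 x₀ y₀ (f1 x₀ y₀ c) = c)
    {x : ℝ} (hx : x ∈ Icc (1 - x₀) y₀) :
    f0 x₀ y₀ (f1 x₀ y₀ x) ∈ Ioo (1 - x₀) y₀ := by
  have e := f0_f1_sub h hc hfix hx
  have ha : (y₀ / x₀) ^ 2 < 1 := pow_lt_one₀ h.a₀_mem.1.le h.a₀_mem.2 two_ne_zero
  have ha' : 0 < (y₀ / x₀) ^ 2 := pow_pos h.a₀_mem.1 2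
  set q := (y₀ / x₀) ^ 2
  have := hc.1
  have := hc.2
  have := hx.1
  have := hx.2
  constructor <;> nlinarith

lemma Icc_subset_pre_two (h : A1 x₀ y₀) (hc : c ∈ Ioo (1 - x₀) y₀)
    (hfix : f0 x₀ y₀ (f1 x₀ y₀ c) = c) :
    Icc (1 - x₀) y₀ ⊆ (pre x₀ y₀)^[2] (Ioo (1 - x₀) y₀) := fun _ hx =>
  mem_pre_iterate_succ.2 (Or.inr (mem_pre_iterate_succ.2 (Or.inl (f0_f1_mem h hc hfix hx))))

lemma Icc_subset_pre_ball (h : A1 x₀ y₀) (hc : c ∈ Ioo (1 - x₀) y₀)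
    (hfix : f0 x₀ y₀ (f1 x₀ y₀ c) = c) (k : ℕ) {ρ : ℝ} (hρ : ((y₀ / x₀) ^ 2) ^ k < ρ) :
    Icc (1 - x₀) y₀ ⊆ (pre x₀ y₀)^[2 * k] (Ioo (c - ρ) (c + ρ)) := by
  have hq : 0 < (y₀ / x₀) ^ 2 := pow_pos h.a₀_mem.1 2
  have key : ∀ k : ℕ, ∀ r : ℝ, ∀ x ∈ Icc (1 - x₀) y₀, ((y₀ / x₀) ^ 2) ^ k * |x - c| < r →
      x ∈ (pre x₀ y₀)^[2 * k] (Ioo (c - r) (c + r)) := by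
    intro k r
    induction k with
    | zero =>
      intro x _ hr
      rw [pow_zero, one_mul, abs_lt] at hr
      exact ⟨by linarith, by linarith⟩
    | succ k ih =>
      intro x hx hr
      refine mem_pre_iterate_succ.2 (Or.inr (mem_pre_iterate_succ.2 (Or.inl ?_)))
      refine ih _ (Ioo_subset_Icc_self (f0_f1_mem h hc hfix hx)) ?_
      rw [f0_f1_sub h hc hfix hx, abs_mul, abs_of_pos hq, ← mul_assoc, ← pow_succ]
      exact hr
  intro x hx
  refine key k ρ x hx (lt_of_le_of_lt ?_ hρ)
  have : |x - c| ≤ 1 := by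
    have := h.2.1
    have := h.2.2.2
    rw [abs_le]; constructor <;> linarith [hc.1, hc.2, hx.1, hx.2]
  exact mul_le_of_le_one_right (pow_nonneg hq.le k) this

/-- Compact subsets of `(0,1)` are moved into any neighbourhood of `c` in a fixed number of
steps. -/
lemma exists_uniform_reach (h : A1 x₀ y₀) (hc : c ∈ Ioo (1 - x₀) y₀)
    (hfix : f0 x₀ y₀ (f1 x₀ y₀ c) = c) {ρ : ℝ} (hρ : 0 < ρ) {K : Set ℝ} (hK : IsCompact K)
    (hK' : K ⊆ Ioo 0 1) :
    ∃ n, K ⊆ (pre x₀ y₀)^[n] (Ioo (c - ρ) (c + ρ)) := by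
  have hJ := Icc_subset_pre_two h hc hfix
  have hmono : Monotone fun k : ℕ => (pre x₀ y₀)^[2 * k] (Ioo (1 - x₀) y₀) :=
    monotone_nat_of_le_succ fun k x hx => pre_iterate_trans hx (Ioo_subset_Icc_self.trans hJ)
  obtain ⟨k, hk⟩ := hK.elim_directed_cover
    (fun k : ℕ => (pre x₀ y₀)^[2 * k] (Ioo (1 - x₀) y₀))
    (fun k => isOpen_pre_iterate h isOpen_Ioo _) (by
      intro x hx
      obtain ⟨n, hn⟩ := exists_reach h (hK' hx)
      rw [mem_iUnion]
      rcases Nat.even_or_odd n with he | ho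
      · obtain ⟨k, rfl⟩ := he.two_dvd
        exact ⟨k + 1, pre_iterate_trans hn hJ⟩
      · have hsub : ∃ m, Odd m ∧ x ∈ (pre x₀ y₀)^[n + m] (Icc (1 - x₀) y₀) := by
          clear hx
          clear ho
          induction n generalizing x with
          | zero =>
            obtain ⟨m, hm, hxm⟩ := exists_odd_return h hn
            exact ⟨m, hm, by rwa [zero_add]⟩
          | succ n ih =>
            rcases mem_pre_iterate_succ.1 hn with h' | h'
            · obtain ⟨m, hm, hxm⟩ := ih h'
              refine ⟨m, hm, ?_⟩
              rw [add_right_comm]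
              exact mem_pre_iterate_succ.2 (Or.inl hxm)
            · obtain ⟨m, hm, hxm⟩ := ih h'
              refine ⟨m, hm, ?_⟩
              rw [add_right_comm]
              exact mem_pre_iterate_succ.2 (Or.inr hxm)
        obtain ⟨m, hm, hxm⟩ := hsub
        obtain ⟨k, hk⟩ := (ho.add_odd hm).two_dvd
        rw [hk] at hxm
        exact ⟨k + 1, pre_iterate_trans hxm hJ⟩)
    (directed_of_isDirected_le hmono)
  obtain ⟨j, hj⟩ := exists_pow_lt_of_lt_one hρ
    (pow_lt_one₀ h.a₀_mem.1.le h.a₀_mem.2 two_ne_zero)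
  exact ⟨2 * k + 2 * j, fun x hx => pre_iterate_trans (hk hx)
    (Ioo_subset_Icc_self.trans (Icc_subset_pre_ball h hc hfix j hj))⟩

end Reach

section Kernel

variable {x₀ y₀ : ℝ} {p₀ p₁ : ℝ → ℝ}

lemma A3.pos (h : A3 p₀ p₁) {x : ℝ} (hx : x ∈ Ioo (0 : ℝ) 1) : 0 < p₀ x ∧ 0 < p₁ x :=
  ⟨(h.2.2 x (Ioo_subset_Icc_self hx)).2.1, (h.2.2 x (Ioo_subset_Icc_self hx)).2.2.2.1⟩

lemma U_mono (h1 : A1 x₀ y₀) (h3 : A3 p₀ p₁) {φ ψ : ℝ → ℝ}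
    (hle : ∀ x ∈ Ioo (0 : ℝ) 1, φ x ≤ ψ x) {x : ℝ} (hx : x ∈ Ioo (0 : ℝ) 1) :
    U x₀ y₀ p₀ p₁ φ x ≤ U x₀ y₀ p₀ p₁ ψ x :=
  add_le_add (mul_le_mul_of_nonneg_left (hle _ (f0_mem h1 hx)) (h3.pos hx).1.le)
    (mul_le_mul_of_nonneg_left (hle _ (f1_mem h1 hx)) (h3.pos hx).2.le)

lemma U_iterate_mono (h1 : A1 x₀ y₀) (h3 : A3 p₀ p₁) {φ ψ : ℝ → ℝ}
    (hle : ∀ x ∈ Ioo (0 : ℝ) 1, φ x ≤ ψ x) (n : ℕ) {x : ℝ} (hx : x ∈ Ioo (0 : ℝ) 1) :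
    (U x₀ y₀ p₀ p₁)^[n] φ x ≤ (U x₀ y₀ p₀ p₁)^[n] ψ x := by
  induction n generalizing x with
  | zero => exact hle x hx
  | succ n ih =>
    rw [Function.iterate_succ_apply', Function.iterate_succ_apply']
    exact U_mono h1 h3 (fun y hy => ih hy) hx

lemma U_iterate_indicator_nonneg (h1 : A1 x₀ y₀) (h3 : A3 p₀ p₁) (S : Set ℝ) (n : ℕ) {x : ℝ}
    (hx : x ∈ Ioo (0 : ℝ) 1) : 0 ≤ (U x₀ y₀ p₀ p₁)^[n] (S.indicator 1) x := by
  induction n generalizing x with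
  | zero => exact indicator_nonneg (fun _ _ => zero_le_one) x
  | succ n ih =>
    rw [Function.iterate_succ_apply']
    exact add_nonneg (mul_nonneg (h3.pos hx).1.le (ih (f0_mem h1 hx)))
      (mul_nonneg (h3.pos hx).2.le (ih (f1_mem h1 hx)))

lemma pow_le_U_iterate_indicator (h1 : A1 x₀ y₀) (h3 : A3 p₀ p₁) {η : ℝ} (hη : 0 < η)
    (hp : ∀ x ∈ Icc (0 : ℝ) 1, η ≤ p₀ x ∧ η ≤ p₁ x) (S : Set ℝ) (n : ℕ) {x : ℝ}
    (hx : x ∈ Ioo (0 : ℝ) 1) (hxS : x ∈ (pre x₀ y₀)^[n] S) :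
    η ^ n ≤ (U x₀ y₀ p₀ p₁)^[n] (S.indicator 1) x := by
  induction n generalizing x with
  | zero =>
    have hxS : x ∈ S := hxS
    simp [hxS]
  | succ n ih =>
    rw [Function.iterate_succ_apply', pow_succ']
    obtain ⟨hp0, hp1⟩ := hp x (Ioo_subset_Icc_self hx)
    have e0 := mul_nonneg (hη.le.trans hp0)
      (U_iterate_indicator_nonneg h1 h3 S n (f0_mem h1 hx))
    have e1 := mul_nonneg (hη.le.trans hp1)
      (U_iterate_indicator_nonneg h1 h3 S n (f1_mem h1 hx))
    rcases mem_pre_iterate_succ.1 hxS with hS | hS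
    · have := mul_le_mul hp0 (ih (f0_mem h1 hx) hS) (pow_nonneg hη.le n) (hη.le.trans hp0)
      exact this.trans (le_add_of_nonneg_right e1)
    · have := mul_le_mul hp1 (ih (f1_mem h1 hx) hS) (pow_nonneg hη.le n) (hη.le.trans hp1)
      exact this.trans (le_add_of_nonneg_left e0)

lemma measurableSet_cyl (w : List Bool) : MeasurableSet (cyl w) := by
  have : cyl w = ⋂ j : Fin w.length, (fun ω : ℕ → Bool => ω j) ⁻¹' {w.get j} := by
    ext ω; simp [cyl]
  rw [this]
  exact MeasurableSet.iInter fun j => measurable_pi_apply _ (measurableSet_singleton _)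

lemma cyl_concat (w : List Bool) (b : Bool) :
    cyl (w ++ [b]) = cyl w ∩ {ω | ω w.length = b} := by
  ext ω
  simp only [cyl, mem_inter_iff, mem_ofPred_eq, List.get_eq_getElem]
  constructor
  · intro h
    refine ⟨fun j => ?_, ?_⟩
    · have := h ⟨j, by simp only [List.length_append]; omega⟩
      simpa [List.getElem_append_left] using this
    · have := h ⟨w.length, by simp⟩
      simpa using this
  · rintro ⟨h, hb⟩ ⟨j, hj⟩
    simp only [List.length_append, List.length_cons, List.length_nil, zero_add] at hj
    rcases Nat.lt_succ_iff_lt_or_eq.1 hj with hlt | rfl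
    · simpa [List.getElem_append_left hlt] using h ⟨j, hlt⟩
    · simpa using hb

/-- The image of `x` under the maps indexed by the word `w`, applied from left to right. -/
noncomputable def wordMap (x₀ y₀ : ℝ) (x : ℝ) (w : List Bool) : ℝ :=
  w.foldl (fun y b => fb x₀ y₀ b y) x

lemma wordMap_mem (h : A1 x₀ y₀) (w : List Bool) {x : ℝ} (hx : x ∈ Ioo (0 : ℝ) 1) :
    wordMap x₀ y₀ x w ∈ Ioo (0 : ℝ) 1 := by
  induction w generalizing x with
  | nil => exact hx
  | cons b w ih => exact ih (fb_mem h b hx)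

lemma cylProb_concat (x : ℝ) (w : List Bool) (b : Bool) :
    cylProb x₀ y₀ p₀ p₁ x (w ++ [b]) = cylProb x₀ y₀ p₀ p₁ x w *
      (if b then p₁ (wordMap x₀ y₀ x w) else p₀ (wordMap x₀ y₀ x w)) := by
  induction w generalizing x with
  | nil => simp [cylProb, wordMap]
  | cons a w ih => simp only [List.cons_append, cylProb, ih, mul_assoc]; rfl

lemma cylProb_nonneg (h1 : A1 x₀ y₀) (h3 : A3 p₀ p₁) (w : List Bool) {x : ℝ}
    (hx : x ∈ Ioo (0 : ℝ) 1) : 0 ≤ cylProb x₀ y₀ p₀ p₁ x w := by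
  induction w generalizing x with
  | nil => exact zero_le_one
  | cons b w ih =>
    refine mul_nonneg ?_ (ih (fb_mem h1 b hx))
    split
    exacts [(h3.pos hx).2.le, (h3.pos hx).1.le]

lemma iter_eq_wordMap (x : ℝ) (w : List Bool) {ω : ℕ → Bool} (hω : ω ∈ cyl w) :
    iter x₀ y₀ ω w.length x = wordMap x₀ y₀ x w := by
  induction w using List.reverseRecOn with
  | nil => rfl
  | append_singleton w b ih =>
    rw [cyl_concat] at hω
    have hb : ω w.length = b := hω.2
    simp [iter, ih hω.1, hb, wordMap]

lemma ofReal_U_iterate_le_cyl (h1 : A1 x₀ y₀) (h3 : A3 p₀ p₁) {Pm : ℝ → Measure (ℕ → Bool)}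
    (hPm : IsKernel x₀ y₀ p₀ p₁ Pm) (S : Set ℝ) (n : ℕ) (w : List Bool) {x : ℝ}
    (hx : x ∈ Ioo (0 : ℝ) 1) :
    ENNReal.ofReal (cylProb x₀ y₀ p₀ p₁ x w *
        (U x₀ y₀ p₀ p₁)^[n] (S.indicator 1) (wordMap x₀ y₀ x w)) ≤
      Pm x (cyl w ∩ {ω | iter x₀ y₀ ω (w.length + n) x ∈ S}) := by
  induction n generalizing w with
  | zero =>
    by_cases hS : wordMap x₀ y₀ x w ∈ S
    · have : cyl w ∩ {ω | iter x₀ y₀ ω (w.length + 0) x ∈ S} = cyl w :=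
        inter_eq_left.2 fun ω hω => by
          rw [mem_ofPred_eq, add_zero, iter_eq_wordMap x w hω]; exact hS
      rw [this, hPm x hx w]
      simp [hS]
    · simp [hS]
  | succ n ih =>
    set T := cyl w ∩ {ω | iter x₀ y₀ ω (w.length + (n + 1)) x ∈ S}
    have hlen : ∀ b : Bool, (w ++ [b]).length + n = w.length + (n + 1) := by
      intro b; simp; omega
    have h0 := ih (w ++ [false])
    have h1' := ih (w ++ [true])
    rw [hlen, cylProb_concat] at h0 h1'
    have hz := wordMap_mem h1 w hx
    have hw0 : wordMap x₀ y₀ x (w ++ [false]) = f0 x₀ y₀ (wordMap x₀ y₀ x w) := by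
      simp [wordMap, fb]
    have hw1 : wordMap x₀ y₀ x (w ++ [true]) = f1 x₀ y₀ (wordMap x₀ y₀ x w) := by
      simp [wordMap, fb]
    rw [hw0] at h0
    rw [hw1] at h1'
    simp only [Bool.false_eq_true, if_false, if_true, mul_assoc] at h0 h1'
    have hc := cylProb_nonneg h1 h3 w hx
    rw [Function.iterate_succ_apply', U, mul_add, ENNReal.ofReal_add
      (mul_nonneg hc (mul_nonneg (h3.pos hz).1.le
        (U_iterate_indicator_nonneg h1 h3 S n (f0_mem h1 hz))))
      (mul_nonneg hc (mul_nonneg (h3.pos hz).2.le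
        (U_iterate_indicator_nonneg h1 h3 S n (f1_mem h1 hz)))),
      ← measure_inter_add_sdiff T (measurableSet_cyl (w ++ [false]))]
    refine add_le_add (h0.trans (measure_mono ?_)) (h1'.trans (measure_mono ?_))
    · rintro ω ⟨hω, hω'⟩
      exact ⟨⟨(cyl_concat w false ▸ hω).1, hω'⟩, hω⟩
    · rintro ω ⟨hω, hω'⟩
      rw [cyl_concat] at hω
      refine ⟨⟨hω.1, hω'⟩, fun h => ?_⟩
      rw [cyl_concat] at h
      have e1 : ω w.length = true := hω.2
      have e2 : ω w.length = false := h.2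
      simp [e1] at e2

lemma ofReal_U_iterate_le (h1 : A1 x₀ y₀) (h3 : A3 p₀ p₁) {Pm : ℝ → Measure (ℕ → Bool)}
    (hPm : IsKernel x₀ y₀ p₀ p₁ Pm) (S : Set ℝ) (n : ℕ) {x : ℝ} (hx : x ∈ Ioo (0 : ℝ) 1) :
    ENNReal.ofReal ((U x₀ y₀ p₀ p₁)^[n] (S.indicator 1) x) ≤
      Pm x {ω | iter x₀ y₀ ω n x ∈ S} := by
  have := ofReal_U_iterate_le_cyl h1 h3 hPm S n [] hx
  simp only [cylProb, one_mul, List.length_nil, zero_add] at this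
  exact this.trans (measure_mono inter_subset_right)

end Kernel

section Drift

variable {x₀ y₀ : ℝ} {p₀ p₁ : ℝ → ℝ}

lemma exists_exp_average_lt_one {p q u v : ℝ} (hpq : p + q = 1)
    (hpos : 0 < p * u + q * v) :
    ∃ α : ℝ, 0 < α ∧ p * Real.exp (-(α * u)) + q * Real.exp (-(α * v)) < 1 := by
  have hd : HasDerivAt (fun α : ℝ => p * Real.exp (-(α * u)) + q * Real.exp (-(α * v)))
      (-(p * u + q * v)) 0 := by
    have hu : HasDerivAt (fun α : ℝ => -(α * u)) (-(1 * u)) 0 :=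
      ((hasDerivAt_id 0).mul_const u).neg
    have hv : HasDerivAt (fun α : ℝ => -(α * v)) (-(1 * v)) 0 :=
      ((hasDerivAt_id 0).mul_const v).neg
    refine ((hu.exp.const_mul p).add (hv.exp.const_mul q)).congr_deriv ?_
    simp; ring
  have ht := hasDerivWithinAt_iff_tendsto_slope.1 (hd.hasDerivWithinAt (s := Ioi 0))
  have hev := ht.eventually (eventually_lt_nhds (neg_neg_of_pos hpos))
  have hset : Ioi (0 : ℝ) \ {0} = Ioi 0 := by simp
  rw [hset] at hev
  obtain ⟨α, hα, hα0⟩ := (hev.and self_mem_nhdsWithin).exists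
  refine ⟨α, hα0, ?_⟩
  rw [slope_def_field, sub_zero, div_neg_iff] at hα
  have hα0 : 0 < α := hα0
  rcases hα with h | h
  · linarith [h.2]
  · have := h.1
    simp [hpq] at this
    linarith

/-- A Lyapunov function blowing up at `0`. -/
lemma exists_drift_zero (h1 : A1 x₀ y₀) (h3 : A3 p₀ p₁)
    (hΛ : 0 < p₀ 0 * Real.log (y₀ / x₀) + p₁ 0 * Real.log ((1 - y₀) / (1 - x₀))) :
    ∃ (V : ℝ → ℝ) (l B : ℝ), 0 < l ∧ l < 1 ∧ 0 ≤ B ∧ (∀ x, 0 ≤ V x) ∧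
      (∀ x ∈ Ioo (0 : ℝ) 1, U x₀ y₀ p₀ p₁ V x ≤ l * V x + B) ∧
      AntitoneOn V (Ioi 0) ∧ ∀ M : ℝ, ∃ κ > 0, ∀ x ∈ Ioo 0 κ, M ≤ V x := by
  obtain ⟨hsum, hp, -, hq, -⟩ := h3.2.2 0 (by simp)
  obtain ⟨α, hα, hlt⟩ := exists_exp_average_lt_one hsum hΛ
  set e₀ := Real.exp (-(α * Real.log (y₀ / x₀)))
  set e₁ := Real.exp (-(α * Real.log ((1 - y₀) / (1 - x₀))))
  obtain ⟨l, hl, hl1⟩ := exists_between hlt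
  have hl0 : 0 < l := lt_trans (by positivity) hl
  have hcont : ContinuousWithinAt (fun x => p₀ x * e₀ + p₁ x * e₁) (Icc 0 1) 0 :=
    ((h3.1 0 (by simp)).mul_const e₀).add ((h3.2.1 0 (by simp)).mul_const e₁)
  have hev := hcont.eventually (eventually_lt_nhds hl)
  obtain ⟨r, hr, hball⟩ := Metric.mem_nhdsWithin_iff.1 hev
  set V : ℝ → ℝ := fun x => Real.exp (-(α * Real.log x)) with hV
  have hVmul : ∀ a x : ℝ, 0 < a → 0 < x →
      V (a * x) = Real.exp (-(α * Real.log a)) * V x := by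
    intro a x ha hx
    simp only [hV]
    rw [Real.log_mul ha.ne' hx.ne', ← Real.exp_add]
    ring_nf
  have hanti : AntitoneOn V (Ioi 0) := by
    intro x hx y hy hxy
    have := mul_le_mul_of_nonneg_left (Real.log_le_log hx hxy) hα.le
    exact Real.exp_le_exp.2 (neg_le_neg this)
  have hx₀ : 0 < 1 - x₀ := by linarith [h1.2.1]
  have hr' : 0 < min r (1 - x₀) := lt_min hr hx₀
  have ha₁ : 0 < (1 - y₀) / (1 - x₀) := zero_lt_one.trans h1.one_lt_a₁
  refine ⟨V, l, V (y₀ / x₀ * min r (1 - x₀)), hl0, hl1, (Real.exp_pos _).le,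
    fun x => (Real.exp_pos _).le, ?_, hanti, ?_⟩
  · intro x hx
    have hVx : 0 ≤ V x := (Real.exp_pos _).le
    rcases lt_or_ge x (min r (1 - x₀)) with hxr | hxr
    · have hb := hball ⟨by simpa [abs_of_pos hx.1] using hxr.trans_le (min_le_left _ _),
        Ioo_subset_Icc_self hx⟩
      change p₀ x * e₀ + p₁ x * e₁ < l at hb
      have hxx := hxr.le.trans (min_le_right _ _)
      rw [U, f0_of_le (by linarith [h1.1]), f1_of_le h1 hxx, hVmul _ _ h1.a₀_mem.1 hx.1,
        hVmul _ _ ha₁ hx.1]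
      have := mul_le_mul_of_nonneg_right hb.le hVx
      have hB : 0 ≤ V (y₀ / x₀ * min r (1 - x₀)) := (Real.exp_pos _).le
      linarith
    · have hlow : y₀ / x₀ * min r (1 - x₀) ≤ y₀ / x₀ * x :=
        mul_le_mul_of_nonneg_left hxr h1.a₀_mem.1.le
      have hbpos : y₀ / x₀ * min r (1 - x₀) ∈ Ioi (0 : ℝ) := mul_pos h1.a₀_mem.1 hr'
      have b0 := hanti hbpos (f0_mem h1 hx).1 (hlow.trans (mul_le_f0 h1))
      have b1 := hanti hbpos (f1_mem h1 hx).1 ((hlow.trans (mul_le_f0 h1)).trans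
        ((f0_le_self h1 hx).trans (self_le_f1 h1 hx)))
      have hs := (h3.2.2 x (Ioo_subset_Icc_self hx)).1
      have m0 := mul_le_mul_of_nonneg_left b0 (h3.pos hx).1.le
      have m1 := mul_le_mul_of_nonneg_left b1 (h3.pos hx).2.le
      have := mul_nonneg hl0.le hVx
      have hB : p₀ x * V (y₀ / x₀ * min r (1 - x₀)) + p₁ x * V (y₀ / x₀ * min r (1 - x₀)) =
          V (y₀ / x₀ * min r (1 - x₀)) := by rw [← add_mul, hs, one_mul]
      rw [U]
      linarith
  · intro M
    refine ⟨Real.exp (-(M / α)), Real.exp_pos _, fun x hx => ?_⟩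
    have hlog : Real.log x < -(M / α) := (Real.log_lt_iff_lt_exp hx.1).2 hx.2
    have : M ≤ -(α * Real.log x) := by
      have := mul_le_mul_of_nonneg_left hlog.le hα.le
      rw [mul_neg, mul_div_cancel₀ _ hα.ne'] at this
      linarith
    linarith [Real.add_one_le_exp (-(α * Real.log x))]

lemma A3.reflect (h : A3 p₀ p₁) : A3 (fun x => p₁ (1 - x)) (fun x => p₀ (1 - x)) := by
  have hmaps : MapsTo (fun x : ℝ => 1 - x) (Icc 0 1) (Icc 0 1) := fun x hx =>
    ⟨by linarith [hx.2], by linarith [hx.1]⟩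
  refine ⟨h.2.1.comp (by fun_prop) hmaps, h.1.comp (by fun_prop) hmaps, fun x hx => ?_⟩
  obtain ⟨a, b, c, d, e⟩ := h.2.2 _ (hmaps hx)
  exact ⟨by rw [add_comm]; exact a, d, e, b, c⟩

lemma U_reflect (V : ℝ → ℝ) (x : ℝ) :
    U x₀ y₀ p₀ p₁ (fun y => V (1 - y)) x =
      U x₀ y₀ (fun y => p₁ (1 - y)) (fun y => p₀ (1 - y)) V (1 - x) := by
  simp only [U, f1, sub_sub_cancel]
  ring

/-- A Lyapunov function blowing up at both ends of `(0,1)`. -/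
lemma exists_drift (h1 : A1 x₀ y₀) (h3 : A3 p₀ p₁) (h4 : A4 x₀ y₀ p₀ p₁) :
    ∃ (V : ℝ → ℝ) (l B : ℝ), 0 < l ∧ l < 1 ∧ 0 ≤ B ∧ (∀ x, 0 ≤ V x) ∧
      (∀ x ∈ Ioo (0 : ℝ) 1, U x₀ y₀ p₀ p₁ V x ≤ l * V x + B) ∧
      (∀ ξ > 0, ∃ C, ∀ x ∈ Icc ξ (1 - ξ), V x ≤ C) ∧
      ∀ M : ℝ, ∃ κ > 0, ∀ x ∈ Ioo (0 : ℝ) 1, x ∉ Icc κ (1 - κ) → M ≤ V x := by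
  obtain ⟨V, l, B, hl, hl1, hB, hV, hU, hanti, hM⟩ := exists_drift_zero h1 h3 h4.1
  obtain ⟨V', l', B', hl', hl1', hB', hV', hU', hanti', hM'⟩ :=
    exists_drift_zero h1 h3.reflect (by simpa [add_comm] using h4.2)
  refine ⟨fun x => V x + V' (1 - x), max l l', B + B', lt_max_of_lt_left hl, max_lt hl1 hl1',
    add_nonneg hB hB', fun x => add_nonneg (hV x) (hV' _), ?_, ?_, ?_⟩
  · intro x hx
    have e : U x₀ y₀ p₀ p₁ (fun x => V x + V' (1 - x)) x =
        U x₀ y₀ p₀ p₁ V x + U x₀ y₀ p₀ p₁ (fun y => V' (1 - y)) x := by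
      simp only [U]; ring
    rw [e, U_reflect]
    have m := mul_le_mul_of_nonneg_right (le_max_left l l') (hV x)
    have m' := mul_le_mul_of_nonneg_right (le_max_right l l') (hV' (1 - x))
    have := hU x hx
    have := hU' _ (one_sub_mem hx)
    linarith
  · refine fun ξ hξ => ⟨V ξ + V' ξ, fun x hx => add_le_add ?_ ?_⟩
    · exact hanti hξ (hξ.trans_le hx.1) hx.1
    · have : ξ ≤ 1 - x := by linarith [hx.2]
      exact hanti' hξ (hξ.trans_le this) this
  · intro M
    obtain ⟨κ, hκ, h⟩ := hM M
    obtain ⟨κ', hκ', h'⟩ := hM' M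
    refine ⟨min κ κ', lt_min hκ hκ', fun x hx hnot => ?_⟩
    rcases lt_or_ge x (min κ κ') with hlt | hge
    · exact (h x ⟨hx.1, hlt.trans_le (min_le_left _ _)⟩).trans
        (le_add_of_nonneg_right (hV' _))
    · have : 1 - min κ κ' < x := by
        by_contra! hle
        exact hnot ⟨hge, hle⟩
      exact (h' (1 - x) ⟨by linarith [hx.2],
        (show 1 - x < min κ κ' by linarith).trans_le (min_le_right _ _)⟩).trans
        (le_add_of_nonneg_left (hV _))

lemma U_iterate_affine_ge (h1 : A1 x₀ y₀) (h3 : A3 p₀ p₁) {V : ℝ → ℝ} {l B : ℝ} (hl : 0 ≤ l)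
    (hl1 : l < 1) (hU : ∀ x ∈ Ioo (0 : ℝ) 1, U x₀ y₀ p₀ p₁ V x ≤ l * V x + B)
    {a b : ℝ} (hb : 0 ≤ b) (n : ℕ) {x : ℝ} (hx : x ∈ Ioo (0 : ℝ) 1) :
    a - b * (l ^ n * V x + B * (1 - l ^ n) / (1 - l)) ≤
      (U x₀ y₀ p₀ p₁)^[n] (fun y => a - b * V y) x := by
  induction n generalizing x with
  | zero => simp
  | succ n ih =>
    rw [Function.iterate_succ_apply']
    refine le_trans ?_ (U_mono h1 h3 (fun y hy => ih hy) hx)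
    have hs := (h3.2.2 x (Ioo_subset_Icc_self hx)).1
    have e : U x₀ y₀ p₀ p₁ (fun y => a - b * (l ^ n * V y + B * (1 - l ^ n) / (1 - l))) x =
        a - b * (l ^ n * U x₀ y₀ p₀ p₁ V x + B * (1 - l ^ n) / (1 - l)) := by
      simp only [U]
      linear_combination (a - b * (B * (1 - l ^ n) / (1 - l))) * hs
    rw [e]
    have hl' : 1 - l ≠ 0 := by linarith
    have e' : l ^ (n + 1) * V x + B * (1 - l ^ (n + 1)) / (1 - l) =
        l ^ n * (l * V x + B) + B * (1 - l ^ n) / (1 - l) := by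
      field_simp; ring
    rw [e']
    have := mul_le_mul_of_nonneg_left (hU x hx) (pow_nonneg hl n)
    gcongr

end Drift

end AM

/-- Lemma 6: with `c` the unique fixed point of `f₀ ∘ f₁` in `[1−x₀, y₀]`, for
every `ρ > 0` there is `δ > 0` such that for every `ξ ∈ (0,1/2)` there is `m` with
`ℙ_x(f^n_ω(x) ∈ (c−ρ, c+ρ)) ≥ δ` for all `n ≥ m` and `x ∈ [ξ, 1−ξ]`. -/
theorem stmt14 (x₀ y₀ : ℝ) (p₀ p₁ : ℝ → ℝ)
    (hA1 : AM.A1 x₀ y₀) (hA2 : AM.A2 p₀ p₁) (hA3 : AM.A3 p₀ p₁) (hA4 : AM.A4 x₀ y₀ p₀ p₁)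
    (Pm : ℝ → MeasureTheory.Measure (ℕ → Bool)) (hPm : AM.IsKernel x₀ y₀ p₀ p₁ Pm)
    (c : ℝ) (hc : c ∈ Set.Ioo (1 - x₀) y₀) (hfix : AM.f0 x₀ y₀ (AM.f1 x₀ y₀ c) = c)
    (huniq : ∀ c' ∈ Set.Icc (1 - x₀) y₀, AM.f0 x₀ y₀ (AM.f1 x₀ y₀ c') = c' → c' = c) :
    ∀ ρ : ℝ, 0 < ρ → ∃ δ : ℝ, 0 < δ ∧
      ∀ ξ : ℝ, 0 < ξ → ξ < 1/2 →
        ∃ m : ℕ, ∀ n ≥ m, ∀ x ∈ Set.Icc ξ (1 - ξ),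
          ENNReal.ofReal δ ≤
            Pm x {ω : ℕ → Bool | AM.iter x₀ y₀ ω n x ∈ Set.Ioo (c - ρ) (c + ρ)} := by
  intro ρ hρ
  obtain ⟨V, l, B, hl, hl1, hB, hV, hU, hVbdd, hVlarge⟩ := AM.exists_drift hA1 hA3 hA4
  obtain ⟨κ, hκ, hcore⟩ := hVlarge (4 * (B / (1 - l) + 1))
  have hD : 0 < 4 * (B / (1 - l) + 1) := by
    have : 0 ≤ B / (1 - l) := div_nonneg hB (by linarith)
    linarith
  set D := 4 * (B / (1 - l) + 1)
  obtain ⟨k, hk⟩ := AM.exists_uniform_reach hA1 hc hfix hρ (K := Icc κ (1 - κ)) isCompact_Icc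
    (fun x hx => ⟨hκ.trans_le hx.1, by linarith [hx.2]⟩)
  obtain ⟨η, hη, hp⟩ : ∃ η : ℝ, 0 < η ∧ ∀ x ∈ Icc (0 : ℝ) 1, η ≤ p₀ x ∧ η ≤ p₁ x := by
    have hne : (Icc (0 : ℝ) 1).Nonempty := nonempty_Icc.2 zero_le_one
    obtain ⟨u, hu, hu'⟩ := isCompact_Icc.exists_isMinOn hne hA3.1
    obtain ⟨v, hv, hv'⟩ := isCompact_Icc.exists_isMinOn hne hA3.2.1
    exact ⟨min (p₀ u) (p₁ v), lt_min (hA3.2.2 u hu).2.1 (hA3.2.2 v hv).2.2.2.1, fun x hx =>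
      ⟨(min_le_left _ _).trans (hu' hx), (min_le_right _ _).trans (hv' hx)⟩⟩
  have hηk : 0 < η ^ k := pow_pos hη k
  refine ⟨η ^ k / 2, by positivity, fun ξ hξ hξ2 => ?_⟩
  obtain ⟨C, hC⟩ := hVbdd ξ hξ
  have hC0 : 0 ≤ C := (hV _).trans (hC ξ ⟨le_rfl, by linarith⟩)
  obtain ⟨m, hm⟩ := exists_pow_lt_of_lt_one (show 0 < 1 / (C + 1) by positivity) hl1
  refine ⟨m + k, fun n hn x hx => ?_⟩
  have hx' : x ∈ Ioo (0 : ℝ) 1 := ⟨hξ.trans_le hx.1, by linarith [hx.2]⟩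
  refine le_trans (ENNReal.ofReal_le_ofReal ?_) (AM.ofReal_U_iterate_le hA1 hA3 hPm _ n hx')
  obtain ⟨j, rfl⟩ : ∃ j, n = j + k := ⟨n - k, by omega⟩
  rw [Function.iterate_add_apply]
  have hlower : ∀ y ∈ Ioo (0 : ℝ) 1, η ^ k - η ^ k / D * V y ≤
      (AM.U x₀ y₀ p₀ p₁)^[k] ((Ioo (c - ρ) (c + ρ)).indicator 1) y := by
    intro y hy
    by_cases hyK : y ∈ Icc κ (1 - κ)
    · have : 0 ≤ η ^ k / D * V y := mul_nonneg (by positivity) (hV y)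
      linarith [AM.pow_le_U_iterate_indicator hA1 hA3 hη hp _ k hy (hk hyK)]
    · have := mul_le_mul_of_nonneg_left (hcore y hy hyK) (show 0 ≤ η ^ k / D by positivity)
      rw [div_mul_cancel₀ _ hD.ne'] at this
      linarith [AM.U_iterate_indicator_nonneg hA1 hA3 (Ioo (c - ρ) (c + ρ)) k hy]
  refine le_trans ?_ (AM.U_iterate_mono hA1 hA3 hlower j hx')
  refine le_trans ?_ (AM.U_iterate_affine_ge hA1 hA3 hl.le hl1 hU
    (show 0 ≤ η ^ k / D by positivity) j hx')
  have hlj : l ^ j ≤ 1 / (C + 1) := (pow_le_pow_of_le_one hl.le hl1.le (by omega)).trans hm.le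
  have hfirst : l ^ j * V x ≤ 1 := by
    calc l ^ j * V x ≤ 1 / (C + 1) * (C + 1) :=
          mul_le_mul hlj ((hC x hx).trans (by linarith)) (hV x) (by positivity)
      _ = 1 := by field_simp
  have hsecond : B * (1 - l ^ j) / (1 - l) ≤ B / (1 - l) := by
    apply div_le_div_of_nonneg_right _ (by linarith)
    exact mul_le_of_le_one_right hB (by linarith [pow_pos hl j])
  have hhalf : η ^ k / D * (l ^ j * V x + B * (1 - l ^ j) / (1 - l)) ≤ η ^ k / D * (D / 2) :=
    mul_le_mul_of_nonneg_left (by simp only [D]; linarith) (by positivity)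
  have : η ^ k / D * (D / 2) = η ^ k / 2 := by field_simp
  linarith
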